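/- Suppose the admissible generation set 𝒢 ⊆ ℝ^𝒯 and the admissible battery set 𝒟 ⊆ ℝ^𝒯 × ℝ^𝒯 are convex. Then the set of realizable prosumption profiles 𝒳 := {x ∈ ℝ^{𝒯×ℬ} : ℱ(x;p) ≠ ∅ for every p ∈ 𝒫} is a convex subset of ℝ^{𝒯×ℬ}. -/

import Mathlib

/-- If the admissible generation set `Gset` and the admissible battery set `Dset`
are convex, then the set of realizable prosumption profiles
`𝒳 = {x | ℱ(x;p) ≠ ∅ for every p ∈ P}` is convex. -/
theorem realizable_prosumption_set_convex
    {T B : Type*} [Fintype T] [Fintype B] [Nonempty T] [Nonempty B]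
    (l : T → ℝ) (ηin ηout : ℝ)
    (hηin : ηin ∈ Set.Ioc (0 : ℝ) 1) (hηout : ηout ∈ Set.Ioc (0 : ℝ) 1)
    (Gset : Set (T → ℝ)) (Dset : Set ((T → ℝ) × (T → ℝ)))
    (P : Set (T → ℝ)) (hP : P.Nonempty)
    (hGconv : Convex ℝ Gset) (hDconv : Convex ℝ Dset) :
    Convex ℝ {x : T → B → ℝ | ∀ p ∈ P,
      ∃ g ∈ Gset, ∃ δ ∈ Dset, ∃ q : T → ℝ,
        (∀ t, 0 ≤ q t ∧ q t ≤ p t) ∧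
        ∀ t, (∑ i, x t i) =
          g t - l t + p t - q t + ηout * δ.2 t - (1 / ηin) * δ.1 t} := by
  intro x hx y hy a b ha hb hab p hp
  obtain ⟨g, hg, d, hd, q, hq, h⟩ := hx p hp
  obtain ⟨g', hg', d', hd', q', hq', h'⟩ := hy p hp
  refine ⟨a • g + b • g', hGconv hg hg' ha hb hab, a • d + b • d',
    hDconv hd hd' ha hb hab, a • q + b • q', ?_, ?_⟩
  · intro t
    obtain ⟨h1, h2⟩ := hq t
    obtain ⟨h3, h4⟩ := hq' t
    simp only [Pi.add_apply, Pi.smul_apply, smul_eq_mul]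
    refine ⟨by positivity, ?_⟩
    calc a * q t + b * q' t ≤ a * p t + b * p t := by gcongr
      _ = p t := by rw [← add_mul, hab, one_mul]
  · intro t
    simp only [Pi.add_apply, Pi.smul_apply, smul_eq_mul, Finset.sum_add_distrib,
      ← Finset.mul_sum, Prod.fst_add, Prod.snd_add, Prod.smul_fst, Prod.smul_snd, h t, h' t]
    linear_combination (p t - l t) * hab
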